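/- Let n ≥ 1 and 0 < α < 1, and define the exponential kernel c_α : ℝ^n × ℝ^n → ℝ by c_α(x, y) = exp(−‖x − y‖^{2α}/2), where ‖·‖ is the Euclidean norm. Define the L¹ modulus of continuity ω(c_α, t) = sup_{(h,h') ∈ ℝ^n × ℝ^n, ‖(h,h')‖ ≤ t} ∫_{[0,1]^n × [0,1]^n} |c_α(x + h, y + h') − c_α(x, y)| dx dy. Then there exists a constant C > 0 such that ω(c_α, t) ≤ C t^α for all t ∈ (0, 1], and for every γ with 0 < γ < α the integral ∫_0^1 t^{−γ} ω(c_α, t) dt/t is finite and bounded by ‖c_α‖_{L¹} + C/(α − γ) minus the L¹ term, i.e. ∫_0^1 t^{−γ−1} ω(c_α, t) dt ≤ C/(α − γ) < ∞; that is, c_α belongs to the Besov space B^γ_{1,1}([0,1]^n × [0,1]^n) for every 0 < γ < α. -/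

import Mathlib

open Real MeasureTheory

/-- The exponential kernel on `ℝ^n × ℝ^n`. -/
noncomputable def expKernel (n : ℕ) (α : ℝ) (x y : EuclideanSpace ℝ (Fin n)) : ℝ :=
  Real.exp (-‖x - y‖ ^ (2 * α) / 2)

/-- The unit cube in `ℝ^n`. -/
def unitCube (n : ℕ) : Set (EuclideanSpace ℝ (Fin n)) :=
  {x | ∀ i, x i ∈ Set.Icc (0:ℝ) 1}

/-- The `L¹` modulus of continuity of the exponential kernel on the unit cube:
`ω(c_α, t) = sup_{‖(h,h')‖ ≤ t} ∫_{[0,1]^n × [0,1]^n} |c_α(x+h, y+h') − c_α(x,y)| dx dy`. -/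
noncomputable def expKernelL1Modulus (n : ℕ) (α t : ℝ) : ℝ :=
  ⨆ p : {p : EuclideanSpace ℝ (Fin n) × EuclideanSpace ℝ (Fin n) // ‖p‖ ≤ t},
    ∫ q in (unitCube n ×ˢ unitCube n),
      |expKernel n α (q.1 + p.1.1) (q.2 + p.1.2) - expKernel n α q.1 q.2|

theorem isCompact_unitCube (n : ℕ) : IsCompact (unitCube n) := by
  have h : unitCube n = (PiLp.continuousLinearEquiv 2 ℝ (fun _ : Fin n => ℝ)).toHomeomorph ⁻¹'
      Set.Icc 0 1 := by
    ext x
    simp [unitCube, Pi.le_def, forall_and]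
  rw [h]
  exact (Homeomorph.isCompact_preimage _).2 isCompact_Icc

theorem abs_exp_neg_sq_half_sub_le (u v : ℝ) :
    |Real.exp (-u ^ 2 / 2) - Real.exp (-v ^ 2 / 2)| ≤ |u - v| := by
  have hd : ∀ x ∈ (Set.univ : Set ℝ), HasDerivWithinAt (fun x : ℝ => Real.exp (-x ^ 2 / 2))
      (Real.exp (-x ^ 2 / 2) * -x) Set.univ x := fun x _ => by
    have h := (((hasDerivAt_pow 2 x).neg).div_const 2).exp
    refine HasDerivAt.hasDerivWithinAt (h.congr_deriv ?_)
    simp only [Pi.neg_apply]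
    push_cast
    ring
  have hb : ∀ x ∈ (Set.univ : Set ℝ), ‖Real.exp (-x ^ 2 / 2) * -x‖ ≤ 1 := fun x _ => by
    have h1 : |x| ≤ Real.exp (x ^ 2 / 2) := by
      have := Real.add_one_le_exp (x ^ 2 / 2)
      nlinarith [sq_nonneg (|x| - 1), sq_abs x]
    rw [norm_mul, norm_neg, Real.norm_eq_abs, Real.norm_eq_abs, Real.abs_exp, neg_div,
      Real.exp_neg]
    exact inv_mul_le_one_of_le₀ h1 (Real.exp_pos _).le
  simpa using convex_univ.norm_image_sub_le_of_norm_hasDerivWithin_le hd hb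
    (Set.mem_univ v) (Set.mem_univ u)

theorem abs_rpow_sub_rpow_le {α s r : ℝ} (hα0 : 0 < α) (hα1 : α ≤ 1) (hs : 0 ≤ s)
    (hr : 0 ≤ r) : |s ^ α - r ^ α| ≤ |s - r| ^ α := by
  wlog h : r ≤ s generalizing s r
  · rw [abs_sub_comm, abs_sub_comm s r]
    exact this hr hs (le_of_not_ge h)
  rw [abs_of_nonneg (sub_nonneg.2 h),
    abs_of_nonneg (sub_nonneg.2 (Real.rpow_le_rpow hr h hα0.le))]
  have := Real.rpow_add_le_add_rpow (sub_nonneg.2 h) hr hα0.le hα1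
  rw [sub_add_cancel] at this
  linarith

theorem abs_expKernel_shift_sub_le {n : ℕ} {α t : ℝ} (hα0 : 0 < α) (hα1 : α < 1)
    {p : EuclideanSpace ℝ (Fin n) × EuclideanSpace ℝ (Fin n)} (hp : ‖p‖ ≤ t)
    (x y : EuclideanSpace ℝ (Fin n)) :
    |expKernel n α (x + p.1) (y + p.2) - expKernel n α x y| ≤ 2 * t ^ α := by
  have ht : 0 ≤ t := (norm_nonneg p).trans hp
  have hsq (z : EuclideanSpace ℝ (Fin n)) : ‖z‖ ^ (2 * α) = (‖z‖ ^ α) ^ 2 := by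
    rw [mul_comm, Real.rpow_mul (norm_nonneg _), Real.rpow_two]
  have hdist : |‖x + p.1 - (y + p.2)‖ - ‖x - y‖| ≤ 2 * t := by
    refine (abs_norm_sub_norm_le _ _).trans ?_
    rw [show x + p.1 - (y + p.2) - (x - y) = p.1 - p.2 by abel]
    linarith [norm_sub_le p.1 p.2, norm_fst_le p, norm_snd_le p]
  unfold expKernel
  rw [hsq, hsq]
  calc _ ≤ |‖x + p.1 - (y + p.2)‖ ^ α - ‖x - y‖ ^ α| := abs_exp_neg_sq_half_sub_le _ _
    _ ≤ |‖x + p.1 - (y + p.2)‖ - ‖x - y‖| ^ α :=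
      abs_rpow_sub_rpow_le hα0 hα1.le (norm_nonneg _) (norm_nonneg _)
    _ ≤ (2 * t) ^ α := Real.rpow_le_rpow (abs_nonneg _) hdist hα0.le
    _ = 2 ^ α * t ^ α := Real.mul_rpow zero_le_two ht
    _ ≤ 2 * t ^ α := by
      gcongr
      exact (Real.rpow_le_rpow_of_exponent_le one_le_two hα1.le).trans_eq (Real.rpow_one 2)

theorem setIntegral_abs_expKernel_shift_sub_le {n : ℕ} {α t : ℝ} (hα0 : 0 < α) (hα1 : α < 1)
    {p : EuclideanSpace ℝ (Fin n) × EuclideanSpace ℝ (Fin n)} (hp : ‖p‖ ≤ t) :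
    ∫ q in (unitCube n ×ˢ unitCube n),
      |expKernel n α (q.1 + p.1) (q.2 + p.2) - expKernel n α q.1 q.2| ≤
      2 * t ^ α * volume.real (unitCube n ×ˢ unitCube n) := by
  refine (Real.le_norm_self _).trans (norm_setIntegral_le_of_norm_le_const
    ((isCompact_unitCube n).prod (isCompact_unitCube n)).measure_lt_top fun q _ => ?_)
  simpa using abs_expKernel_shift_sub_le hα0 hα1 hp q.1 q.2

theorem expKernelL1Modulus_nonneg (n : ℕ) (α t : ℝ) : 0 ≤ expKernelL1Modulus n α t :=
  Real.iSup_nonneg fun _ => integral_nonneg fun _ => abs_nonneg _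

theorem expKernelL1Modulus_le {n : ℕ} {α t : ℝ} (hα0 : 0 < α) (hα1 : α < 1) (ht : 0 ≤ t) :
    expKernelL1Modulus n α t ≤ 2 * t ^ α * volume.real (unitCube n ×ˢ unitCube n) :=
  Real.iSup_le (fun p => setIntegral_abs_expKernel_shift_sub_le hα0 hα1 p.2) (by positivity)

theorem expKernelL1Modulus_monotone {n : ℕ} {α : ℝ} (hα0 : 0 < α) (hα1 : α < 1) :
    Monotone (expKernelL1Modulus n α) := fun s t hst => by
  refine Real.iSup_le (fun p => ?_) (expKernelL1Modulus_nonneg n α t)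
  refine le_ciSup (f := fun p : {p : EuclideanSpace ℝ (Fin n) × EuclideanSpace ℝ (Fin n) //
    ‖p‖ ≤ t} => ∫ q in (unitCube n ×ˢ unitCube n),
      |expKernel n α (q.1 + p.1.1) (q.2 + p.1.2) - expKernel n α q.1 q.2|)
    ⟨2 * t ^ α * volume.real (unitCube n ×ˢ unitCube n), ?_⟩ ⟨p.1, p.2.trans hst⟩
  rintro _ ⟨p, rfl⟩
  exact setIntegral_abs_expKernel_shift_sub_le hα0 hα1 p.2

/-- The exponential kernel `c_α` has `L¹` modulus of continuity `O(t^α)`, and hence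
belongs to the Besov space `B^γ_{1,1}([0,1]^n × [0,1]^n)` for every `0 < γ < α`. -/
theorem exp_kernel_besov
    (n : ℕ) (hn : 1 ≤ n) (α : ℝ) (hα0 : 0 < α) (hα1 : α < 1) :
    ∃ C > 0, (∀ t ∈ Set.Ioc (0:ℝ) 1, expKernelL1Modulus n α t ≤ C * t ^ α) ∧
      ∀ γ : ℝ, 0 < γ → γ < α →
        IntegrableOn (fun t => t ^ (-γ - 1) * expKernelL1Modulus n α t)
          (Set.Ioc (0:ℝ) 1) ∧
        ∫ t in Set.Ioc (0:ℝ) 1, t ^ (-γ - 1) * expKernelL1Modulus n α t ≤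
          C / (α - γ) := by
  set K := volume.real (unitCube n ×ˢ unitCube n)
  have hK : 0 ≤ K := measureReal_nonneg
  have hω : ∀ t ∈ Set.Ioc (0:ℝ) 1, expKernelL1Modulus n α t ≤ (2 * K + 1) * t ^ α := by
    intro t ht
    have h1 : expKernelL1Modulus n α t ≤ 2 * t ^ α * K := expKernelL1Modulus_le hα0 hα1 ht.1.le
    nlinarith [Real.rpow_nonneg ht.1.le α]
  refine ⟨2 * K + 1, by positivity, hω, fun γ _ hγα => ?_⟩
  have hbound : ∀ t ∈ Set.Ioc (0:ℝ) 1, t ^ (-γ - 1) * expKernelL1Modulus n α t ≤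
      (2 * K + 1) * t ^ (α - γ - 1) := by
    intro t ht
    calc _ ≤ t ^ (-γ - 1) * ((2 * K + 1) * t ^ α) :=
          mul_le_mul_of_nonneg_left (hω t ht) (Real.rpow_nonneg ht.1.le _)
      _ = _ := by
        rw [show α - γ - 1 = (-γ - 1) + α by ring, Real.rpow_add ht.1]
        ring
  have hmaj : IntegrableOn (fun t : ℝ => (2 * K + 1) * t ^ (α - γ - 1)) (Set.Ioc 0 1) :=
    ((intervalIntegrable_iff_integrableOn_Ioc_of_le zero_le_one).1
      (intervalIntegral.intervalIntegrable_rpow' (by linarith))).const_mul _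
  have hint : IntegrableOn (fun t => t ^ (-γ - 1) * expKernelL1Modulus n α t)
      (Set.Ioc (0:ℝ) 1) := by
    refine hmaj.mono' ((measurable_id.pow_const _).mul
      (expKernelL1Modulus_monotone hα0 hα1).measurable).aestronglyMeasurable ?_
    filter_upwards [ae_restrict_mem measurableSet_Ioc] with t ht
    rw [Real.norm_of_nonneg (mul_nonneg (Real.rpow_nonneg ht.1.le _)
      (expKernelL1Modulus_nonneg n α t))]
    exact hbound t ht
  refine ⟨hint, (setIntegral_mono_on hint hmaj measurableSet_Ioc hbound).trans_eq ?_⟩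
  rw [integral_const_mul, ← intervalIntegral.integral_of_le zero_le_one,
    integral_rpow (Or.inl (by linarith)), sub_add_cancel, Real.one_rpow,
    Real.zero_rpow (by linarith), sub_zero, mul_one_div]
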